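/- (Hu) Let G be a Hamiltonian bipartite graph on 2n vertices with n > 3. If e(G) > n(n−1)/2 + 2, then G contains cycles of every possible even length, i.e., cycles of length 2k for every 2 ≤ k ≤ n. -/

import Mathlib

def hasCycleLength {V : Type*} (G : SimpleGraph V) (l : ℕ) : Prop :=
  ∃ (v : V) (p : G.Walk v v), p.IsCycle ∧ p.length = l

/-- A labelling `x` of the vertices of a cycle of length `L` in `G` by `ZMod L`. -/
structure IsCyclicLabelling {V : Type*} (G : SimpleGraph V) (L : ℕ) (x : ZMod L → V) : Prop where
  inj : Function.Injective x
  adj : ∀ i, G.Adj (x i) (x (i + 1))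

theorem hasCycleLength_of_isChain {V : Type*} {G : SimpleGraph V} {v : V} {t : List V}
    (hnd : (v :: t).Nodup) (hch : (v :: t ++ [v]).IsChain G.Adj) (hlen : 2 ≤ t.length) :
    hasCycleLength G (t.length + 1) := by
  have hne : v :: t ++ [v] ≠ [] := by simp
  obtain ⟨q, hsupp, hq⟩ : ∃ q : G.Walk v v,
      q.support = v :: t ++ [v] ∧ q.length = t.length + 1 := by
    have copy {a b : V} (p : G.Walk a b) (ha : a = v) (hb : b = v) :
        ∃ q : G.Walk v v, q.support = p.support ∧ q.length = p.length := by
      subst ha hb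
      exact ⟨p, rfl, rfl⟩
    obtain ⟨q, h1, h2⟩ := copy (SimpleGraph.Walk.ofSupport (v :: t ++ [v]) hne hch)
      (by simp) (by simp)
    exact ⟨q, by rw [h1, SimpleGraph.Walk.support_ofSupport],
      by rw [h2, SimpleGraph.Walk.length_ofSupport]; simp⟩
  refine ⟨v, q, ?_, hq⟩
  rw [SimpleGraph.Walk.isCycle_iff_isPath_tail_and_le_length]
  refine ⟨?_, by omega⟩
  have hnn : ¬ q.Nil := by
    intro h
    have := SimpleGraph.Walk.length_eq_zero_iff.mpr h
    omega
  rw [SimpleGraph.Walk.isPath_def, SimpleGraph.Walk.support_tail_of_not_nil _ hnn]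
  rw [hsupp]
  simpa [List.nodup_append, and_comm, eq_comm, List.forall_mem_ne] using hnd

theorem exists_isCyclicLabelling_of_isChain {V : Type*} {G : SimpleGraph V} {v : V} {t : List V}
    {L : ℕ} (hnd : (v :: t).Nodup) (hch : (v :: t ++ [v]).IsChain G.Adj)
    (hL : t.length + 1 = L) :
    ∃ y : ZMod L → V, IsCyclicLabelling G L y ∧ ∀ i, y i ∈ v :: t := by
  have : NeZero L := ⟨by omega⟩
  have hlt (i : ZMod L) : i.val < (v :: t).length := by
    have := ZMod.val_lt i
    simpa [hL] using this
  refine ⟨fun i ↦ (v :: t)[i.val]'(hlt i), ⟨fun i j h ↦ ?_, fun i ↦ ?_⟩, fun i ↦ List.getElem_mem _⟩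
  · exact ZMod.val_injective L ((List.Nodup.getElem_inj_iff hnd).mp h)
  · rw [List.isChain_iff_getElem] at hch
    have h1 := hch i.val (by have := hlt i; simp at this ⊢; omega)
    have h2 : (i + 1).val = (i.val + 1) % L := by
      rw [ZMod.val_add, ZMod.val_one_eq_one_mod, Nat.add_mod_mod]
    have h3 := hlt i
    rw [List.getElem_append_left h3] at h1
    by_cases h : i.val + 1 = L
    · have h4 : (i + 1).val = 0 := by rw [h2, h, Nat.mod_self]
      rw [List.getElem_append_right (by simp; omega)] at h1
      simpa [h4] using h1
    · have h5 := ZMod.val_lt i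
      have h4 : (i + 1).val = i.val + 1 := by rw [h2, Nat.mod_eq_of_lt (by omega)]
      rw [List.getElem_append_left (by simp; omega)] at h1
      simpa only [h4] using h1

namespace IsCyclicLabelling

variable {V : Type*} {G : SimpleGraph V} {L : ℕ} {x : ZMod L → V}

theorem shift (hx : IsCyclicLabelling G L x) (a : ZMod L) :
    IsCyclicLabelling G L fun i ↦ x (a + i) :=
  ⟨fun i j h ↦ add_left_cancel (hx.inj h), fun i ↦ by
    have := hx.adj (a + i)
    rwa [add_assoc] at this⟩

theorem adj_nat (hx : IsCyclicLabelling G L x) (i : ℕ) : G.Adj (x (i : ℕ)) (x ((i + 1 : ℕ))) := by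
  simpa using hx.adj i

theorem natCast_injOn (hx : IsCyclicLabelling G L x) {i j : ℕ} (hi : i < L) (hj : j < L)
    (h : x i = x j) : i = j := by
  have := hx.inj h
  rw [ZMod.natCast_eq_natCast_iff'] at this
  rwa [Nat.mod_eq_of_lt hi, Nat.mod_eq_of_lt hj] at this

theorem hasCycleLength_self (hx : IsCyclicLabelling G L x) (hL : 3 ≤ L) : hasCycleLength G L := by
  have hnd : ((List.range' 1 (L - 1)).map fun i : ℕ ↦ x i).length + 1 = L := by simp; omega
  have hs : (x 0 :: (List.range' 1 (L - 1)).map fun i : ℕ ↦ x i) =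
      (List.range' 0 L).map fun i : ℕ ↦ x i := by
    obtain ⟨m, rfl⟩ : ∃ m, L = m + 1 := ⟨L - 1, by omega⟩
    simp [List.range'_succ]
  have hs' : (x 0 :: ((List.range' 1 (L - 1)).map fun i : ℕ ↦ x i) ++ [x 0]) =
      (List.range' 0 (L + 1)).map fun i : ℕ ↦ x i := by
    rw [hs, List.range'_concat]
    simp
  have := hasCycleLength_of_isChain (G := G) (v := x 0)
    (t := (List.range' 1 (L - 1)).map fun i : ℕ ↦ x i) ?_ ?_ (by simp; omega)
  · rwa [hnd] at this
  · rw [hs]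
    refine List.Nodup.map_on ?_ List.nodup_range'
    intro i hi j hj h
    simp only [List.mem_range'_1] at hi hj
    exact hx.natCast_injOn (by omega) (by omega) h
  · rw [hs', List.isChain_map]
    refine (List.isChain_range' 0 (L + 1) 1).imp ?_
    rintro i j rfl
    exact hx.adj_nat i

/-- If some path `0 :: q` from `0` to `l` visits all but two of the vertices `0, …, l` of a cycle,
then replacing this segment by the path gives a cycle shorter by two. -/
theorem exists_of_segment (hx : IsCyclicLabelling G L x) {q : List ℕ} {l : ℕ} (hl : l + 1 ≤ L)
    (hnd : (0 :: q).Nodup) (hle : ∀ i ∈ q, i ≤ l) (hlast : (0 :: q).getLast? = some l)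
    (hq : q.length + 2 = l)
    (hch : (0 :: q).IsChain fun i j : ℕ ↦ G.Adj (x i) (x j)) :
    ∃ y : ZMod (L - 2) → V, IsCyclicLabelling G (L - 2) y ∧ ∀ i, y i ∈ Set.range x := by
  have hfull : (x 0 :: (q ++ List.range' (l + 1) (L - (l + 1))).map (fun i : ℕ ↦ x i)) =
      (0 :: (q ++ List.range' (l + 1) (L - (l + 1)))).map fun i : ℕ ↦ x i := by simp
  have key := exists_isCyclicLabelling_of_isChain (G := G) (v := x 0)
    (t := (q ++ List.range' (l + 1) (L - (l + 1))).map fun i : ℕ ↦ x i) (L := L - 2) ?_ ?_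
    (by simp; omega)
  · obtain ⟨y, hy, hmem⟩ := key
    refine ⟨y, hy, fun i ↦ ?_⟩
    have := hmem i
    rw [hfull, List.mem_map] at this
    obtain ⟨j, -, hj⟩ := this
    exact ⟨_, hj⟩
  · rw [hfull]
    refine List.Nodup.map_on ?_ ?_
    · have (i : ℕ) (hi : i ∈ 0 :: (q ++ List.range' (l + 1) (L - (l + 1)))) : i < L := by
        simp only [List.mem_cons, List.mem_append, List.mem_range'_1] at hi
        rcases hi with rfl | hi | hi
        · omega
        · have := hle i hi; omega
        · omega
      intro i hi j hj h
      exact hx.natCast_injOn (this i hi) (this j hj) h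
    · rw [← List.cons_append, List.nodup_append]
      refine ⟨hnd, List.nodup_range', fun i hi j hj ↦ ?_⟩
      simp only [List.mem_cons, List.mem_range'_1] at hi hj
      rcases hi with rfl | hi
      · omega
      · have := hle i hi; omega
  · have : (x 0 :: (q ++ List.range' (l + 1) (L - (l + 1))).map (fun i : ℕ ↦ x i) ++ [x 0]) =
      ((0 :: q) ++ List.range' (l + 1) (L - (l + 1) + 1)).map fun i : ℕ ↦ x i := by
      rw [hfull, List.range'_concat]
      simp [show l + 1 + (L - (l + 1)) = L by omega]
    rw [this, List.isChain_map, List.isChain_append]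
    refine ⟨hch, (List.isChain_range' _ _ 1).imp ?_, ?_⟩
    · rintro i j rfl
      exact hx.adj_nat i
    · intro i hi j hj
      rw [hlast] at hi
      simp only [Option.mem_def, Option.some.injEq] at hi
      simp [List.range'_succ] at hj
      subst hi hj
      exact hx.adj_nat _

end IsCyclicLabelling

theorem sum_window_le (a b : ℕ → Prop) [DecidablePred a] [DecidablePred b]
    (haa : ∀ j, a j → ¬ a (j + 2)) (hbb : ∀ j, b j → ¬ b (j + 2)) (hab : ∀ j, a j → ¬ b (j + 1))
    (hba : ∀ j, b j → ¬ a (j + 3)) (haba : ∀ j, a j → b (j + 3) → ¬ a (j + 4)) :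
    ∑ j ∈ Finset.range 4, ((if a (2 * j) then 1 else 0) + if b (2 * j + 1) then 1 else 0) ≤ 3 := by
  have h1 := haa 0
  have h2 := haa 2
  have h3 := haa 4
  have h4 := hbb 1
  have h5 := hbb 3
  have h6 := hbb 5
  have h7 := hab 0
  have h8 := hab 2
  have h9 := hab 4
  have h10 := hab 6
  have h11 := hba 1
  have h12 := hba 3
  have h13 := haba 0
  have h14 := haba 2
  simp only [Finset.sum_range_succ, Finset.sum_range_zero, Nat.reduceAdd, Nat.reduceMul] at *
  clear haa hbb hab hba haba
  grind

theorem sum_zmod_eq_sum_range {N : ℕ} [NeZero N] (f : ZMod N → ℕ) :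
    ∑ a, f a = ∑ i ∈ Finset.range N, f i := by
  symm
  refine Finset.sum_nbij' (fun i ↦ (i : ZMod N)) ZMod.val ?_ ?_ ?_ ?_ ?_
  · simp
  · intro a _
    simpa using ZMod.val_lt a
  · intro i hi
    exact ZMod.val_cast_of_lt (by simpa using hi)
  · simp
  · simp

theorem sum_range_two_mul (f : ℕ → ℕ) (n : ℕ) :
    ∑ i ∈ Finset.range (2 * n), f i = ∑ t ∈ Finset.range n, (f (2 * t) + f (2 * t + 1)) := by
  induction n with
  | zero => simp
  | succ n ih => rw [Nat.mul_succ, Finset.sum_range_succ, Finset.sum_range_succ, ih,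
      Finset.sum_range_succ, add_assoc]

theorem sum_zmod_add_right {N : ℕ} [NeZero N] (f : ZMod N → ℕ) (c : ZMod N) :
    ∑ a, f (a + c) = ∑ a, f a :=
  Equiv.sum_comp (Equiv.addRight c) f

namespace IsCyclicLabelling

variable {V : Type*} {G : SimpleGraph V} {L : ℕ} {x : ZMod L → V}

open Classical in
/-- The number of (positions of) chords of the cycle `x` joining vertices at distance `d`. -/
noncomputable def chordCount (G : SimpleGraph V) [NeZero L] (x : ZMod L → V) (d : ZMod L) : ℕ :=
  ∑ a, if G.Adj (x a) (x (a + d)) then 1 else 0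

open Classical in
theorem sum_chordCount [NeZero L] :
    ∑ d, chordCount G x d = ∑ i, ∑ j, if G.Adj (x i) (x j) then 1 else 0 := by
  unfold chordCount
  rw [Finset.sum_comm]
  exact Finset.sum_congr rfl fun a _ ↦ Equiv.sum_comp (Equiv.addLeft a)
    fun j ↦ if G.Adj (x a) (x j) then 1 else 0

theorem chordCount_neg [NeZero L] (d : ZMod L) : chordCount G x (-d) = chordCount G x d := by
  classical
  unfold chordCount
  rw [← sum_zmod_add_right _ d]
  simp [G.adj_comm]

theorem chordCount_le [NeZero L] (d : ZMod L) : chordCount G x d ≤ L := by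
  classical
  unfold chordCount
  calc _ ≤ ∑ a : ZMod L, 1 := Finset.sum_le_sum fun a _ ↦ by split_ifs <;> simp
    _ = L := by simp [ZMod.card]

theorem chordCount_eq_zero [NeZero L] {d : ZMod L} (h : ∀ a, ¬ G.Adj (x a) (x (a + d))) :
    chordCount G x d = 0 := by
  classical
  simp [chordCount, h]

theorem two_mul_chordCount_le [NeZero L] {d : ZMod L}
    (h : ∀ a, G.Adj (x a) (x (a + d)) → ¬ G.Adj (x (a + 2)) (x (a + 2 + d))) :
    2 * chordCount G x d ≤ L := by
  classical
  have : chordCount G x d + chordCount G x d ≤ L := by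
    unfold chordCount
    nth_rw 2 [← sum_zmod_add_right _ 2]
    rw [← Finset.sum_add_distrib]
    calc _ ≤ ∑ a : ZMod L, 1 := Finset.sum_le_sum fun a _ ↦ by have := h a; split_ifs <;> simp_all
      _ = L := by simp [ZMod.card]
  omega

theorem chordCount_five_add_seven_le [NeZero L]
    (haa : ∀ a, G.Adj (x a) (x (a + 5)) → ¬ G.Adj (x (a + 2)) (x (a + 2 + 5)))
    (hbb : ∀ a, G.Adj (x a) (x (a + 7)) → ¬ G.Adj (x (a + 2)) (x (a + 2 + 7)))
    (hab : ∀ a, G.Adj (x a) (x (a + 5)) → ¬ G.Adj (x (a + 1)) (x (a + 1 + 7)))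
    (hba : ∀ a, G.Adj (x a) (x (a + 7)) → ¬ G.Adj (x (a + 3)) (x (a + 3 + 5)))
    (haba : ∀ a, G.Adj (x a) (x (a + 5)) → G.Adj (x (a + 3)) (x (a + 3 + 7)) →
      ¬ G.Adj (x (a + 4)) (x (a + 4 + 5))) :
    4 * (chordCount G x 5 + chordCount G x 7) ≤ 3 * L := by
  classical
  have window (c : ZMod L) : ∑ j ∈ Finset.range 4,
      ((if G.Adj (x (c + (2 * j : ℕ))) (x (c + (2 * j : ℕ) + 5)) then 1 else 0) +
        if G.Adj (x (c + (2 * j + 1 : ℕ))) (x (c + (2 * j + 1 : ℕ) + 7)) then 1 else 0) ≤ 3 := by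
    refine sum_window_le (fun j ↦ G.Adj (x (c + j)) (x (c + j + 5)))
      (fun j ↦ G.Adj (x (c + j)) (x (c + j + 7))) ?_ ?_ ?_ ?_ ?_ <;> intro j <;>
      simp only [Nat.cast_add, ← add_assoc] <;> push_cast
    · exact haa _
    · exact hbb _
    · exact hab _
    · exact hba _
    · exact haba _
  have := Finset.sum_le_sum fun c (_ : c ∈ Finset.univ) ↦ window c
  rw [Finset.sum_comm] at this
  simp only [Finset.sum_add_distrib] at this
  have hA (d : ZMod L) (j : ℕ) : (∑ c, if G.Adj (x (c + j)) (x (c + j + d)) then 1 else 0) =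
      chordCount G x d :=
    sum_zmod_add_right (fun c ↦ if G.Adj (x c) (x (c + d)) then 1 else 0) j
  simp only [hA] at this
  simp [ZMod.card] at this
  omega

/-- `G` has a cycle on all but two vertices of the cycle `x`. -/
def HasShorter (G : SimpleGraph V) (x : ZMod L → V) : Prop :=
  ∃ y : ZMod (L - 2) → V, IsCyclicLabelling G (L - 2) y ∧ ∀ i, y i ∈ Set.range x

theorem hasShorter_of_path (hx : IsCyclicLabelling G L x) (a : ZMod L) (q : List ℕ) (l : ℕ)
    (hl : l + 1 ≤ L) (hnd : (0 :: q).Nodup) (hle : ∀ i ∈ q, i ≤ l)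
    (hlast : (0 :: q).getLast? = some l) (hq : q.length + 2 = l)
    (hch : (0 :: q).IsChain fun i j : ℕ ↦ G.Adj (x (a + i)) (x (a + j))) : HasShorter G x := by
  obtain ⟨y, hy, hr⟩ := (hx.shift a).exists_of_segment hl hnd hle hlast hq hch
  refine ⟨y, hy, fun i ↦ ?_⟩
  obtain ⟨j, hj⟩ := hr i
  exact ⟨_, hj⟩

theorem adj_add_nat (hx : IsCyclicLabelling G L x) (a : ZMod L) (i j : ℕ) (h : i + 1 = j) :
    G.Adj (x (a + i)) (x (a + j)) := by
  subst h
  simpa [add_assoc] using hx.adj (a + i)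

theorem chordCount_three [NeZero L] (hx : IsCyclicLabelling G L x) (hL : 4 ≤ L)
    (h : ¬ HasShorter G x) : chordCount G x 3 = 0 := by
  refine chordCount_eq_zero fun a ha ↦ h (hx.hasShorter_of_path a [3] 3 hL ?_ ?_ ?_ ?_ ?_)
  any_goals simp
  exact ha

theorem two_mul_chordCount_odd_le [NeZero L] (hx : IsCyclicLabelling G L x) {d : ℕ} (hd : 2 ≤ d)
    (hL : d + 3 ≤ L) (h : ¬ HasShorter G x) : 2 * chordCount G x d ≤ L := by
  refine two_mul_chordCount_le fun a h1 h2 ↦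
    h (hx.hasShorter_of_path a ((List.range' 2 (d - 1)).reverse ++ [d + 2]) (d + 2) hL
      ?_ ?_ ?_ ?_ ?_)
  · simp [List.nodup_append, List.nodup_range']
    omega
  · simp
    omega
  · rw [← List.cons_append, List.getLast?_concat]
  · simp
    omega
  · have hr : (List.range' 2 (d - 1)).reverse.IsChain
        fun i j : ℕ ↦ G.Adj (x (a + i)) (x (a + j)) := by
      rw [List.isChain_reverse]
      refine (List.isChain_range' _ _ 1).imp ?_
      rintro i j rfl
      exact (hx.adj_add_nat a _ _ rfl).symm
    rw [← List.cons_append, List.isChain_append]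
    obtain ⟨e, rfl⟩ : ∃ e, d = e + 2 := ⟨d - 2, by omega⟩
    refine ⟨?_, by simp, ?_⟩
    · rw [List.isChain_cons]
      refine ⟨fun i hi ↦ ?_, hr⟩
      rw [show e + 2 - 1 = e + 1 by omega, List.range'_concat, List.reverse_append] at hi
      simp only [List.reverse_singleton, List.singleton_append, List.head?_cons, Option.mem_def,
        Option.some.injEq] at hi
      subst hi
      simpa [add_comm] using h1
    · intro i hi j hj
      rw [show e + 2 - 1 = e + 1 by omega, List.range'_succ, List.reverse_cons,
        ← List.cons_append, List.getLast?_concat] at hi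
      simp only [Option.mem_def, Option.some.injEq, List.head?_cons] at hi hj
      subst hi hj
      simp only [Nat.cast_add, Nat.cast_ofNat] at h2 ⊢
      convert h2 using 2
      ring

theorem four_mul_chordCount_five_add_seven_le [NeZero L] (hx : IsCyclicLabelling G L x)
    (hL : 12 ≤ L) (h : ¬ HasShorter G x) :
    4 * (chordCount G x 5 + chordCount G x 7) ≤ 3 * L := by
  have hpath (a : ZMod L) (q : List ℕ) (l : ℕ) (hl : l < 12) (hnd : (0 :: q).Nodup)
      (hle : ∀ i ∈ q, i ≤ l) (hlast : (0 :: q).getLast? = some l) (hq : q.length + 2 = l) :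
      ¬ (0 :: q).IsChain fun i j : ℕ ↦ G.Adj (x (a + i)) (x (a + j)) :=
    fun hch ↦ h (hx.hasShorter_of_path a q l (by omega) hnd hle hlast hq hch)
  have hup := hx.adj_add_nat
  have cast (a : ZMod L) (i d j : ℕ) (hj : i + d = j) (h : G.Adj (x (a + i)) (x (a + i + d))) :
      G.Adj (x (a + i)) (x (a + j)) := by
    subst hj
    rwa [Nat.cast_add, ← add_assoc]
  refine chordCount_five_add_seven_le ?_ ?_ ?_ ?_ ?_ <;> intro a
  · intro h1 h2
    have h1 := cast a 0 5 5 rfl (by simpa using h1)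
    have h2 := cast a 2 5 7 rfl (by simpa using h2)
    refine hpath a [5, 4, 3, 2, 7] 7 (by decide) (by decide) (by decide) (by decide) (by decide) ?_
    simp only [List.isChain_cons_cons, List.isChain_singleton, and_true]
    refine ⟨?_, ?_, ?_, ?_, ?_⟩
    all_goals first | assumption | exact hup _ _ _ rfl | exact (hup _ _ _ rfl).symm
  · intro h1 h2
    have h1 := cast a 0 7 7 rfl (by simpa using h1)
    have h2 := cast a 2 7 9 rfl (by simpa using h2)
    refine hpath a [7, 6, 5, 4, 3, 2, 9] 9 (by decide) (by decide) (by decide) (by decide)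
      (by decide) ?_
    simp only [List.isChain_cons_cons, List.isChain_singleton, and_true]
    refine ⟨?_, ?_, ?_, ?_, ?_, ?_, ?_⟩
    all_goals first | assumption | exact hup _ _ _ rfl | exact (hup _ _ _ rfl).symm
  · intro h1 h2
    have h1 := cast a 0 5 5 rfl (by simpa using h1)
    have h2 := cast a 1 7 8 rfl (by simpa using h2)
    refine hpath a [5, 4, 3, 2, 1, 8] 8 (by decide) (by decide) (by decide) (by decide)
      (by decide) ?_
    simp only [List.isChain_cons_cons, List.isChain_singleton, and_true]
    refine ⟨?_, ?_, ?_, ?_, ?_, ?_⟩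
    all_goals first | assumption | exact hup _ _ _ rfl | exact (hup _ _ _ rfl).symm
  · intro h1 h2
    have h1 := cast a 0 7 7 rfl (by simpa using h1)
    have h2 := cast a 3 5 8 rfl (by simpa using h2)
    refine hpath a [7, 6, 5, 4, 3, 8] 8 (by decide) (by decide) (by decide) (by decide)
      (by decide) ?_
    simp only [List.isChain_cons_cons, List.isChain_singleton, and_true]
    refine ⟨?_, ?_, ?_, ?_, ?_, ?_⟩
    all_goals first | assumption | exact hup _ _ _ rfl | exact (hup _ _ _ rfl).symm
  · intro h1 h2 h3
    have h1 := cast a 0 5 5 rfl (by simpa using h1)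
    have h2 := cast a 3 7 10 rfl (by simpa using h2)
    have h3 := cast a 4 5 9 rfl (by simpa using h3)
    refine hpath a [5, 6, 7, 8, 9, 4, 3, 10] 10 (by decide) (by decide) (by decide) (by decide)
      (by decide) ?_
    simp only [List.isChain_cons_cons, List.isChain_singleton, and_true]
    refine ⟨?_, ?_, ?_, ?_, ?_, ?_, ?_, ?_⟩
    all_goals first | assumption | exact h3.symm | exact hup _ _ _ rfl |
      exact (hup _ _ _ rfl).symm

theorem color_add_one {c : V → Bool} (hx : IsCyclicLabelling G L x)
    (hc : ∀ u v, G.Adj u v → c u ≠ c v) (i : ZMod L) : c (x (i + 1)) = !c (x i) := by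
  have := hc _ _ (hx.adj i)
  revert this
  cases c (x i) <;> cases c (x (i + 1)) <;> simp

theorem color_add_two_mul {c : V → Bool} (hx : IsCyclicLabelling G L x)
    (hc : ∀ u v, G.Adj u v → c u ≠ c v) (i : ZMod L) (t : ℕ) :
    c (x (i + (2 * t : ℕ))) = c (x i) := by
  induction t with
  | zero => simp
  | succ t ih =>
    have : i + ((2 * (t + 1) : ℕ) : ZMod L) = i + ((2 * t : ℕ) : ZMod L) + 1 + 1 := by
      push_cast
      ring
    rw [this, hx.color_add_one hc, hx.color_add_one hc, ih, Bool.not_not]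

theorem chordCount_two_mul [NeZero L] {c : V → Bool} (hx : IsCyclicLabelling G L x)
    (hc : ∀ u v, G.Adj u v → c u ≠ c v) (t : ℕ) : chordCount G x ((2 * t : ℕ) : ZMod L) = 0 :=
  chordCount_eq_zero fun a ha ↦ hc _ _ ha (hx.color_add_two_mul hc a t).symm

theorem hasShorter_of_chords {n : ℕ} [NeZero (2 * n)] {x : ZMod (2 * n) → V} (hn : 4 ≤ n)
    (hx : IsCyclicLabelling G (2 * n) x) {c : V → Bool} (hc : ∀ u v, G.Adj u v → c u ≠ c v)
    (hE : n * n + 6 ≤ ∑ d, chordCount G x d + n) : HasShorter G x := by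
  by_contra h
  rw [sum_zmod_eq_sum_range, sum_range_two_mul] at hE
  simp only [hx.chordCount_two_mul hc, zero_add] at hE
  set f : ℕ → ℕ := fun t ↦ chordCount G x ((2 * t + 1 : ℕ) : ZMod (2 * n)) with hf
  have hsymm (t s : ℕ) (hts : t + s + 1 = n) : f t = f s := by
    have : ((2 * t + 1 : ℕ) : ZMod (2 * n)) = - ((2 * s + 1 : ℕ) : ZMod (2 * n)) := by
      rw [eq_neg_iff_add_eq_zero, ← Nat.cast_add, show 2 * t + 1 + (2 * s + 1) = 2 * n by omega,
        ZMod.natCast_self]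
    simp only [hf, this, chordCount_neg]
  have h0 : f 0 ≤ 2 * n := chordCount_le _
  have h1 : f 1 = 0 := hx.chordCount_three (by omega) h
  have hle (t : ℕ) (ht : 2 ≤ t) (htn : t + 2 ≤ n) : f t ≤ n := by
    have := hx.two_mul_chordCount_odd_le (d := 2 * t + 1) (by omega) (by omega) h
    simp only [hf]
    omega
  have h23 (h6 : 6 ≤ n) : 2 * (f 2 + f 3) ≤ 3 * n := by
    have := hx.four_mul_chordCount_five_add_seven_le (by omega) h
    have e2 : f 2 = chordCount G x 5 := rfl
    have e3 : f 3 = chordCount G x 7 := rfl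
    omega
  obtain rfl | rfl | rfl | rfl | hn : n = 4 ∨ n = 5 ∨ n = 6 ∨ n = 7 ∨ 8 ≤ n := by omega
  · have := hsymm 0 3 rfl
    have := hsymm 1 2 rfl
    simp only [Finset.sum_range_succ, Finset.sum_range_zero] at hE
    omega
  · have := hsymm 0 4 rfl
    have := hsymm 1 3 rfl
    have := hle 2 le_rfl (by omega)
    simp only [Finset.sum_range_succ, Finset.sum_range_zero] at hE
    omega
  · have := hsymm 0 5 rfl
    have := hsymm 1 4 rfl
    have := h23 (by omega)
    simp only [Finset.sum_range_succ, Finset.sum_range_zero] at hE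
    omega
  · have := hsymm 0 6 rfl
    have := hsymm 1 5 rfl
    have := h23 (by omega)
    have := hle 4 (by omega) (by omega)
    simp only [Finset.sum_range_succ, Finset.sum_range_zero] at hE
    omega
  · obtain ⟨m, rfl⟩ : ∃ m, n = m + 4 + 4 := ⟨n - 8, by omega⟩
    have := hsymm 0 (m + 4 + 3) (by omega)
    have := hsymm 1 (m + 4 + 2) (by omega)
    have := hsymm 2 (m + 4 + 1) (by omega)
    have := hsymm 3 (m + 4) (by omega)
    have := h23 (by omega)
    have hmid : ∑ t ∈ Finset.range m, f (t + 4) ≤ m * (m + 4 + 4) := by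
      calc _ ≤ ∑ t ∈ Finset.range m, (m + 4 + 4) := Finset.sum_le_sum fun t ht ↦
            hle _ (by omega) (by have := Finset.mem_range.mp ht; omega)
        _ = _ := by simp
    have hsum : ∑ t ∈ Finset.range (m + 4), f t =
        ∑ t ∈ Finset.range m, f (t + 4) + f 3 + f 2 + f 1 + f 0 := by
      rw [Finset.sum_range_succ', Finset.sum_range_succ', Finset.sum_range_succ',
        Finset.sum_range_succ']
    simp only [Finset.sum_range_succ _ (m + 4 + 3), Finset.sum_range_succ _ (m + 4 + 2),
      Finset.sum_range_succ _ (m + 4 + 1), Finset.sum_range_succ _ (m + 4)] at hE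
    change _ ≤ ∑ t ∈ Finset.range (m + 4), f t + f (m + 4) + f (m + 4 + 1) + f (m + 4 + 2) +
      f (m + 4 + 3) + _ at hE
    rw [hsum] at hE
    nlinarith

theorem hasCycleLength_of_ear (hx : IsCyclicLabelling G L x) {s : List V} {u : V}
    (hs : (u :: s).Nodup) (hsx : ∀ w ∈ u :: s, w ∉ Set.range x) (hch : (s ++ [u]).IsChain G.Adj)
    {a : ZMod L} {d : ℕ} (hd : 1 ≤ d) (hdL : d < L) (hu : G.Adj u (x a))
    (hw : ∀ w ∈ (s ++ [u]).head?, G.Adj (x (a + d)) w) :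
    hasCycleLength G (d + s.length + 2) := by
  have key := hasCycleLength_of_isChain (G := G) (v := u)
    (t := (List.range' 0 (d + 1)).map (fun i : ℕ ↦ x (a + i)) ++ s) ?_ ?_ (by simp; omega)
  · convert key using 1
    simp
    omega
  · rw [← List.perm_middle.nodup_iff, List.nodup_append]
    refine ⟨List.Nodup.map_on (fun i hi j hj h ↦ ?_) List.nodup_range', hs, fun v hv w hw ↦ ?_⟩
    · simp only [List.mem_range'_1] at hi hj
      exact (hx.shift a).natCast_injOn (by omega) (by omega) h
    · rintro rfl
      obtain ⟨i, -, rfl⟩ := List.mem_map.mp hv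
      exact hsx _ hw ⟨_, rfl⟩
  · rw [List.cons_append, List.append_assoc, List.isChain_cons, List.isChain_append,
      List.isChain_map]
    refine ⟨?_, (List.isChain_range' _ _ 1).imp ?_, hch, ?_⟩
    · simpa [List.range'_succ] using hu
    · rintro i j rfl
      exact (hx.shift a).adj_nat i
    · simpa [List.range'_concat] using hw

variable [NeZero L] {c : V → Bool}

theorem two_mul_card_color (hx : IsCyclicLabelling G L x) (hc : ∀ u v, G.Adj u v → c u ≠ c v)
    (b : Bool) : 2 * (Finset.univ.filter fun i ↦ c (x i) = b).card = L := by
  have h1 : (Finset.univ.filter fun i ↦ c (x i) = b).card =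
      (Finset.univ.filter fun i ↦ ¬ c (x i) = b).card := by
    refine Finset.card_equiv (Equiv.addRight 1) fun i ↦ ?_
    simp only [Finset.mem_filter, Finset.mem_univ, true_and, Equiv.coe_addRight,
      hx.color_add_one hc]
    cases c (x i) <;> cases b <;> simp
  have h2 := Finset.card_filter_add_card_filter_not (s := (Finset.univ : Finset (ZMod L)))
    (fun i ↦ c (x i) = b)
  rw [Finset.card_univ, ZMod.card] at h2
  omega

open Classical in
/-- The positions of the neighbours of `u` on the cycle `x`. -/
noncomputable def nbr (G : SimpleGraph V) (x : ZMod L → V) (u : V) : Finset (ZMod L) :=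
  Finset.univ.filter fun i ↦ G.Adj u (x i)

theorem mem_nbr {u : V} {i : ZMod L} : i ∈ nbr G x u ↔ G.Adj u (x i) := by simp [nbr]

/-- A set `P` of positions and a translate of a set `Q` of positions that lie in the same colour
class meet if their total size exceeds half the length of the cycle. -/
theorem exists_mem_of_card {P Q : Finset (ZMod L)} (hx : IsCyclicLabelling G L x)
    (hc : ∀ u v, G.Adj u v → c u ≠ c v) {b : Bool} (hP : ∀ i ∈ P, c (x i) = b) {s : ZMod L}
    (hQ : ∀ i ∈ Q, c (x (i + s)) = b) (hcard : L < 2 * (P.card + Q.card)) :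
    ∃ i ∈ Q, i + s ∈ P := by
  classical
  by_contra! h
  have hdisj : Disjoint P (Q.map (Equiv.addRight s).toEmbedding) := by
    rw [Finset.disjoint_left]
    intro i hi hi'
    obtain ⟨j, hj, rfl⟩ := Finset.mem_map.mp hi'
    exact h j hj hi
  have hsub : P ∪ Q.map (Equiv.addRight s).toEmbedding ⊆
      Finset.univ.filter fun i ↦ c (x i) = b := by
    intro i hi
    rw [Finset.mem_filter]
    refine ⟨Finset.mem_univ _, ?_⟩
    rcases Finset.mem_union.mp hi with hi | hi
    · exact hP i hi
    · obtain ⟨j, hj, rfl⟩ := Finset.mem_map.mp hi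
      exact hQ j hj
  have h1 := Finset.card_le_card hsub
  rw [Finset.card_union_of_disjoint hdisj, Finset.card_map] at h1
  have h2 := hx.two_mul_card_color hc b
  omega

theorem color_of_mem_nbr (hc : ∀ u v, G.Adj u v → c u ≠ c v) {u : V} {i : ZMod L}
    (hi : i ∈ nbr G x u) : c (x i) = !c u := by
  have := hc _ _ (mem_nbr.mp hi)
  revert this
  cases c u <;> cases c (x i) <;> simp

theorem hasCycleLength_of_mem_nbr (hx : IsCyclicLabelling G L x) {u : V} (hu : u ∉ Set.range x)
    {i : ZMod L} {k : ℕ} (hk : 2 ≤ k) (hkL : 2 * k ≤ L) (hi : i ∈ nbr G x u)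
    (hi' : i + (2 * (k - 1) : ℕ) ∈ nbr G x u) : hasCycleLength G (2 * k) := by
  have := hx.hasCycleLength_of_ear (s := []) (u := u) (by simp) (by simpa using hu) (by simp)
    (d := 2 * (k - 1)) (by omega) (by omega) (mem_nbr.mp hi) (by
      simpa using (mem_nbr.mp hi').symm)
  convert this using 1
  simp
  omega

theorem hasCycleLength_of_card_nbr (hx : IsCyclicLabelling G L x)
    (hc : ∀ u v, G.Adj u v → c u ≠ c v) {u : V} (hu : u ∉ Set.range x)
    (hcard : L < 4 * (nbr G x u).card) {k : ℕ} (hk : 2 ≤ k) (hkL : 2 * k ≤ L) :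
    hasCycleLength G (2 * k) := by
  obtain ⟨i, hi, hi'⟩ := hx.exists_mem_of_card hc (P := nbr G x u) (Q := nbr G x u)
    (fun i hi ↦ color_of_mem_nbr hc hi) (s := (2 * (k - 1) : ℕ))
    (fun i hi ↦ by rw [hx.color_add_two_mul hc, color_of_mem_nbr hc hi]) (by omega)
  exact hx.hasCycleLength_of_mem_nbr hu hk hkL hi hi'

theorem add_one_mem_nbr (hx : IsCyclicLabelling G L x)
    (hc : ∀ u v, G.Adj u v → c u ≠ c v) {v w : V} (hv : v ∉ Set.range x) (hw : w ∉ Set.range x)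
    (hvw : G.Adj v w) (hcard : L = 2 * ((nbr G x v).card + (nbr G x w).card))
    {k : ℕ} (hk : 2 ≤ k) (hkL : 2 * k ≤ L) (h : ¬ hasCycleLength G (2 * k))
    {i : ZMod L} (hi : i ∈ nbr G x v) : i + 1 ∈ nbr G x w := by
  classical
  by_contra hi1
  have hcvw : c v = !c w := by
    have := hc _ _ hvw
    revert this
    cases c v <;> cases c w <;> simp
  have hcol (j : ZMod L) : c (x (j + ((2 * (k - 2) + 1 : ℕ) : ZMod L))) = !c (x j) := by
    rw [Nat.cast_add, ← add_assoc, Nat.cast_one, hx.color_add_one hc, hx.color_add_two_mul hc]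
  have hQ : ∀ j ∈ insert (i + 1) (nbr G x w),
      c (x (j + ((2 * (k - 2) + 1 : ℕ) : ZMod L))) = !c v := by
    intro j hj
    rw [hcol]
    rcases Finset.mem_insert.mp hj with rfl | hj
    · rw [hx.color_add_one hc, color_of_mem_nbr hc hi, Bool.not_not]
    · rw [color_of_mem_nbr hc hj, hcvw]
  obtain ⟨j, hj, hj'⟩ := hx.exists_mem_of_card hc (P := nbr G x v)
    (Q := insert (i + 1) (nbr G x w)) (fun i hi ↦ color_of_mem_nbr hc hi)
    (s := (2 * (k - 2) + 1 : ℕ)) hQ (by rw [Finset.card_insert_of_notMem hi1]; omega)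
  · rcases Finset.mem_insert.mp hj with rfl | hj
    · refine h (hx.hasCycleLength_of_mem_nbr hv hk hkL hi ?_)
      convert hj' using 1
      rw [show 2 * (k - 1) = 1 + (2 * (k - 2) + 1) by omega, Nat.cast_add, Nat.cast_one, add_assoc]
    · refine h ?_
      have := hx.hasCycleLength_of_ear (s := [v]) (u := w) (by simpa using hvw.ne') (by simp_all)
        (by simpa using hvw) (d := 2 * (k - 2) + 1) (by omega) (by omega) (mem_nbr.mp hj) (by
          simpa using (mem_nbr.mp hj').symm)
      convert this using 1
      simp
      omega

theorem hasCycleLength_of_adj (hx : IsCyclicLabelling G L x)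
    (hc : ∀ u v, G.Adj u v → c u ≠ c v) {v w : V} (hv : v ∉ Set.range x) (hw : w ∉ Set.range x)
    (hvw : G.Adj v w) (hcard : L = 2 * ((nbr G x v).card + (nbr G x w).card))
    (hne : (nbr G x v).Nonempty)
    {k : ℕ} (hk : 2 ≤ k) (hkL : 2 * k ≤ L) : hasCycleLength G (2 * k) := by
  by_contra h
  obtain ⟨i, hi⟩ := hne
  have step (t : ℕ) : i + (2 * t : ℕ) ∈ nbr G x v := by
    induction t with
    | zero => simpa using hi
    | succ t ih =>
      have h1 := hx.add_one_mem_nbr hc hv hw hvw hcard hk hkL h ih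
      have h2 := hx.add_one_mem_nbr hc hw hv hvw.symm (by omega) hk hkL h h1
      convert h2 using 1
      push_cast
      ring
  exact h (hx.hasCycleLength_of_mem_nbr hv hk hkL hi (step _))

end IsCyclicLabelling

open Classical in
/-- Twice the number of edges of `G` inside `S`. -/
noncomputable def adjCount {V : Type*} (G : SimpleGraph V) (S : Finset V) : ℕ :=
  ∑ u ∈ S, ∑ v ∈ S, if G.Adj u v then 1 else 0

namespace IsCyclicLabelling

variable {V : Type*} {G : SimpleGraph V} {L : ℕ} {x : ZMod L → V}

theorem sum_chordCount_eq_adjCount [NeZero L] (hx : IsCyclicLabelling G L x) {S : Finset V}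
    (hS : (S : Set V) = Set.range x) : ∑ d, chordCount G x d = adjCount G S := by
  classical
  have : S = Finset.univ.map ⟨x, hx.inj⟩ := by
    apply Finset.coe_injective
    simp [hS]
  simp only [sum_chordCount, adjCount, this, Finset.sum_map, Function.Embedding.coeFn_mk]

theorem hasCycleLength_four [NeZero L] (hx : IsCyclicLabelling G L x) (hL : 4 ≤ L)
    (h : chordCount G x 3 ≠ 0) : hasCycleLength G 4 := by
  obtain ⟨a, ha⟩ : ∃ a, G.Adj (x a) (x (a + 3)) := by
    by_contra! h'
    exact h (chordCount_eq_zero h')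
  have := hx.adj_add_nat a
  refine hasCycleLength_of_isChain (v := x (a + (0 : ℕ)))
    (t := [1, 2, 3].map fun i : ℕ ↦ x (a + i)) ?_ ?_ (by simp)
  · change ([0, 1, 2, 3].map fun i : ℕ ↦ x (a + i)).Nodup
    refine List.Nodup.map_on (fun i hi j hj h ↦ ?_) (by decide)
    have hle : ∀ i ∈ [0, 1, 2, 3], i < 4 := by decide
    have := hle i hi
    have := hle j hj
    exact (hx.shift a).natCast_injOn (by omega) (by omega) h
  · simp only [List.map_cons, List.map_nil, List.cons_append, List.nil_append,
      List.isChain_cons_cons, List.isChain_singleton, and_true]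
    exact ⟨this _ _ rfl, this _ _ rfl, this _ _ rfl, by simpa using ha.symm⟩

theorem chordCount_three_ne_zero {x : ZMod (2 * 4) → V} {c : V → Bool}
    (hx : IsCyclicLabelling G (2 * 4) x) (hc : ∀ u v, G.Adj u v → c u ≠ c v)
    (hE : 17 ≤ ∑ d, chordCount G x d) : chordCount G x 3 ≠ 0 := by
  intro h
  have h5 : chordCount G x 5 = chordCount G x 3 := by
    rw [← chordCount_neg]
    rfl
  have h1 : chordCount G x 1 ≤ 8 := chordCount_le 1
  have h7 : chordCount G x 7 ≤ 8 := chordCount_le 7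
  have he := hx.chordCount_two_mul hc
  rw [sum_zmod_eq_sum_range, sum_range_two_mul] at hE
  simp only [he, zero_add, Finset.sum_range_succ, Finset.sum_range_zero] at hE
  simp at hE
  omega

end IsCyclicLabelling

open IsCyclicLabelling in
theorem hasCycleLength_of_adjCount {V : Type*} {G : SimpleGraph V} {c : V → Bool}
    (hc : ∀ u v, G.Adj u v → c u ≠ c v) {n : ℕ} (hn : 4 ≤ n) :
    ∀ (S : Finset V) (x : ZMod (2 * n) → V), IsCyclicLabelling G (2 * n) x →
      (S : Set V) = Set.range x → n * n + 6 ≤ adjCount G S + n →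
      ∀ k, 2 ≤ k → k ≤ n → hasCycleLength G (2 * k) := by
  classical
  induction n, hn using Nat.le_induction with
  | base =>
    intro S x hx hS hE k hk hkn
    rw [← hx.sum_chordCount_eq_adjCount hS] at hE
    obtain rfl | rfl | rfl : k = 2 ∨ k = 3 ∨ k = 4 := by omega
    · exact hx.hasCycleLength_four (by omega) (hx.chordCount_three_ne_zero hc (by omega))
    · obtain ⟨y, hy, -⟩ := hx.hasShorter_of_chords le_rfl hc hE
      exact hy.hasCycleLength_self (by omega)
    · exact hx.hasCycleLength_self (by omega)
  | succ m hm ih =>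
    intro S x hx hS hE k hk hkn
    obtain rfl | hkm : k = m + 1 ∨ k ≤ m := by omega
    · exact hx.hasCycleLength_self (by omega)
    have hsh := hx.hasShorter_of_chords (by omega) hc
      (by rwa [hx.sum_chordCount_eq_adjCount hS])
    unfold HasShorter at hsh
    rw [show 2 * (m + 1) - 2 = 2 * m by omega] at hsh
    obtain ⟨y, hy, hyx⟩ := hsh
    have : NeZero (2 * m) := ⟨by omega⟩
    set T : Finset V := Finset.univ.map ⟨y, hy.inj⟩ with hT
    have hTy : (T : Set V) = Set.range y := by simp [hT]
    have hmemT (u : V) : u ∈ T ↔ u ∈ Set.range y := by rw [← hTy, Finset.mem_coe]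
    have hScard : S.card = 2 * (m + 1) := by
      have : S = Finset.univ.map ⟨x, hx.inj⟩ := by
        apply Finset.coe_injective
        simp [hS]
      rw [this, Finset.card_map, Finset.card_univ, ZMod.card]
    have hTcard : T.card = 2 * m := by rw [hT, Finset.card_map, Finset.card_univ, ZMod.card]
    have hTS : T ⊆ S := by
      intro u hu
      obtain ⟨i, rfl⟩ := (hmemT u).mp hu
      rw [← Finset.mem_coe, hS]
      exact hyx i
    have hdiff : (S \ T).card = 2 := by
      rw [Finset.card_sdiff_of_subset hTS]
      omega
    obtain ⟨v, w, hvw, hvwST⟩ := Finset.card_eq_two.mp hdiff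
    have hv : v ∈ S \ T := by simp [hvwST]
    have hw : w ∈ S \ T := by simp [hvwST]
    have hvT := (Finset.mem_sdiff.mp hv).2
    have hwT := (Finset.mem_sdiff.mp hw).2
    have hST : S = insert v (insert w T) := by
      rw [← Finset.sdiff_union_of_subset hTS, hvwST]
      ext u
      simp
    have hvy : v ∉ Set.range y := by rwa [← hmemT]
    have hwy : w ∉ Set.range y := by rwa [← hmemT]
    by_cases hv4 : 2 * m < 4 * (nbr G y v).card
    · exact hy.hasCycleLength_of_card_nbr hc hvy hv4 hk (by omega)
    by_cases hw4 : 2 * m < 4 * (nbr G y w).card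
    · exact hy.hasCycleLength_of_card_nbr hc hwy hw4 hk (by omega)
    have hnbr (u : V) : ∑ t ∈ T, (if G.Adj u t then 1 else 0) = (nbr G y u).card := by
      rw [hT, Finset.sum_map, nbr, Finset.card_filter]
      rfl
    have hcount : adjCount G S = adjCount G T +
        2 * ((nbr G y v).card + (nbr G y w).card + if G.Adj v w then 1 else 0) := by
      have hvI : v ∉ insert w T := by simp [hvw, hvT]
      rw [adjCount, hST]
      have hnbr' (u : V) : ∑ t ∈ T, (if G.Adj t u then 1 else 0) = (nbr G y u).card := by
        simp only [G.adj_comm _ u, hnbr]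
      simp only [Finset.sum_insert hvI, Finset.sum_insert hwT, Finset.sum_add_distrib, hnbr, hnbr',
        SimpleGraph.irrefl, if_false]
      simp only [G.adj_comm w v, adjCount, hnbr]
      ring
    by_cases hadj : G.Adj v w ∧ 2 * m = 2 * ((nbr G y v).card + (nbr G y w).card)
    · exact hy.hasCycleLength_of_adj hc hvy hwy hadj.1 hadj.2
        (Finset.card_pos.mp (by omega)) hk (by omega)
    · refine ih T y hy hTy ?_ k hk hkm
      have : (nbr G y v).card + (nbr G y w).card + (if G.Adj v w then 1 else 0) ≤ m := by
        split_ifs with h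
        · have : ¬ 2 * m = 2 * ((nbr G y v).card + (nbr G y w).card) := fun h' ↦ hadj ⟨h, h'⟩
          omega
        · omega
      have e : (m + 1) * (m + 1) = m * m + 2 * m + 1 := by ring
      omega

theorem adjCount_univ {V : Type*} [Fintype V] (G : SimpleGraph V) :
    adjCount G Finset.univ = 2 * G.edgeSet.ncard := by
  classical
  have := G.sum_degrees_eq_twice_card_edges
  rw [Set.ncard_eq_toFinset_card', ← SimpleGraph.edgeFinset, ← this, adjCount]
  refine Finset.sum_congr rfl fun u _ ↦ ?_
  rw [← Finset.card_filter, ← SimpleGraph.card_neighborFinset_eq_degree,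
    SimpleGraph.neighborFinset_eq_filter]

theorem SimpleGraph.Walk.IsHamiltonianCycle.exists_isCyclicLabelling {V : Type*} [Fintype V]
    [DecidableEq V] {G : SimpleGraph V} {v : V} {p : G.Walk v v} (hp : p.IsHamiltonianCycle)
    {L : ℕ} (hL : Fintype.card V = L) :
    ∃ x : ZMod L → V, IsCyclicLabelling G L x ∧ Set.range x = Set.univ := by
  have hlen : p.length = L := by rw [hp.length_eq, hL]
  have : NeZero L := ⟨by have := hp.isCycle.three_le_length; omega⟩
  have hinj : Function.Injective fun i : ZMod L ↦ p.getVert i.val := by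
    intro i j h
    have hi := ZMod.val_lt i
    have hj := ZMod.val_lt j
    exact ZMod.val_injective L (hp.isCycle.getVert_injOn' (by simp; omega) (by simp; omega) h)
  refine ⟨fun i ↦ p.getVert i.val, ⟨hinj, fun i ↦ ?_⟩, ?_⟩
  · have hi := ZMod.val_lt i
    have h1 := p.adj_getVert_succ (i := i.val) (by omega)
    have h2 : (i + 1).val = (i.val + 1) % L := by
      rw [ZMod.val_add, ZMod.val_one_eq_one_mod, Nat.add_mod_mod]
    obtain h | h : i.val + 1 = L ∨ i.val + 1 < L := by omega
    · rw [h2, h, Nat.mod_self, p.getVert_zero]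
      rwa [p.getVert_of_length_le (by omega : p.length ≤ i.val + 1)] at h1
    · rwa [h2, Nat.mod_eq_of_lt h]
  · rw [Set.range_eq_univ]
    exact ((Fintype.bijective_iff_injective_and_card _).mpr
      ⟨hinj, by rw [ZMod.card, hL]⟩).surjective

/-- (Hu) Let `G` be a Hamiltonian bipartite graph on `2n` vertices, `n > 3`. If
`e(G) > n(n-1)/2 + 2`, then `G` contains cycles of every even length `2k`, `2 ≤ k ≤ n`. -/
theorem hu_pancyclic (n : ℕ) (hn : 3 < n)
    (G : SimpleGraph (Fin n ⊕ Fin n))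
    (hG : G ≤ completeBipartiteGraph (Fin n) (Fin n))
    (hham : ∃ (v : Fin n ⊕ Fin n) (p : G.Walk v v), p.IsHamiltonianCycle)
    (he : n * (n - 1) / 2 + 2 < G.edgeSet.ncard) :
    ∀ k : ℕ, 2 ≤ k → k ≤ n → hasCycleLength G (2 * k) := by
  obtain ⟨v, p, hp⟩ := hham
  obtain ⟨x, hx, hrange⟩ := hp.exists_isCyclicLabelling (L := 2 * n) (by simp; omega)
  refine hasCycleLength_of_adjCount (c := Sum.isLeft) (fun u v h ↦ ?_) hn Finset.univ x hx
    (by simp [hrange]) ?_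
  · have := hG h
    cases u <;> cases v <;> simp_all
  · rw [adjCount_univ]
    obtain ⟨m, rfl⟩ : ∃ m, n = m + 1 := ⟨n - 1, by omega⟩
    have h2 : 2 ∣ (m + 1) * m := by
      rw [mul_comm]
      exact (Nat.even_mul_succ_self m).two_dvd
    have e : (m + 1) * (m + 1) = (m + 1) * m + (m + 1) := by ring
    rw [Nat.add_sub_cancel] at he
    omega
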